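/- arXiv:math/0403174 — 2 statements merged into one kernel-verified Lean document; each statement's English description precedes it below -/
import Mathlib

section
/- Let B : [0,∞) → [0,∞) be a non-decreasing function and let φ : [0,∞) → [0,∞) be a twice continuously differentiable non-increasing function satisfying the differential inequality 4 · φ(t) · B(φ(t)) ≤ φ''(t) for all t > 0. Then for every T > 0, 4 · ∫_{φ(T)²}^{φ(0)²} B(√x) dx ≤ (φ'(0))². -/
open MeasureTheory intervalIntegral
open scoped ENNReal

/-- The key integrated differential inequality in the proof of Theorem 2.1: if
`φ : [0,∞) → [0,∞)` is twice continuously differentiable, non-increasing, with first and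
second derivatives `φ'`, `φ''`, if `B : [0,∞) → [0,∞)` is non-decreasing, and if
`4 φ(t) B(φ(t)) ≤ φ''(t)` for all `t > 0`, then for every `T > 0`,
`4 ∫_{φ(T)²}^{φ(0)²} B(√x) dx ≤ (φ'(0))²`. -/
theorem integrated_differential_inequality
    (B : ℝ → ℝ)
    (hB0 : ∀ x : ℝ, 0 ≤ x → 0 ≤ B x)
    (hBmono : ∀ x y : ℝ, 0 ≤ x → x ≤ y → B x ≤ B y)
    (φ φ' φ'' : ℝ → ℝ)
    (hφ0 : ∀ t ∈ Set.Ici (0 : ℝ), 0 ≤ φ t)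
    (hd1 : ∀ t ∈ Set.Ici (0 : ℝ), HasDerivWithinAt φ (φ' t) (Set.Ici 0) t)
    (hd2 : ∀ t ∈ Set.Ici (0 : ℝ), HasDerivWithinAt φ' (φ'' t) (Set.Ici 0) t)
    (hcont : ContinuousOn φ'' (Set.Ici 0))
    (hmono : AntitoneOn φ (Set.Ici 0))
    (hineq : ∀ t : ℝ, 0 < t → 4 * φ t * B (φ t) ≤ φ'' t) :
    ∀ T : ℝ, 0 < T →
      4 * ∫ x in ((φ T) ^ 2)..((φ 0) ^ 2), B (Real.sqrt x) ≤ (φ' 0) ^ 2 := by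
  intro T hT
  have hIcc : ∀ t ∈ Set.Icc (0 : ℝ) T, t ∈ Set.Ici (0 : ℝ) := fun t ht => ht.1
  have hd1' : ∀ t ∈ Set.Ioo (0 : ℝ) T, HasDerivAt φ (φ' t) t := fun t ht =>
    (hd1 t ht.1.le).hasDerivAt (Ici_mem_nhds ht.1)
  have hd2' : ∀ t ∈ Set.Ioo (0 : ℝ) T, HasDerivAt φ' (φ'' t) t := fun t ht =>
    (hd2 t ht.1.le).hasDerivAt (Ici_mem_nhds ht.1)
  have hcφ : ContinuousOn φ (Set.Icc 0 T) := fun t ht =>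
    (hd1 t ht.1).continuousWithinAt.mono hIcc
  have hcφ' : ContinuousOn φ' (Set.Icc 0 T) := fun t ht =>
    (hd2 t ht.1).continuousWithinAt.mono hIcc
  have hφ'_nonpos : ∀ t ∈ Set.Ioo (0 : ℝ) T, φ' t ≤ 0 := fun t ht => by
    rw [← (hd1' t ht).hasDerivWithinAt.derivWithin (uniqueDiffOn_Ici 0 t ht.1.le)]
    exact hmono.derivWithin_nonpos
  have hsq_deriv : ∀ t ∈ Set.Ioo (0 : ℝ) T,
      HasDerivAt (fun t => φ t ^ 2) (2 * φ t * φ' t) t := fun t ht => by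
    simpa using (hd1' t ht).fun_pow 2
  have hsq_nonpos : ∀ t ∈ Set.Ioo (0 : ℝ) T, 2 * φ t * φ' t ≤ 0 := fun t ht =>
    mul_nonpos_of_nonneg_of_nonpos (mul_nonneg two_pos.le (hφ0 t ht.1.le)) (hφ'_nonpos t ht)
  have hle : φ T ^ 2 ≤ φ 0 ^ 2 :=
    pow_le_pow_left₀ (hφ0 T hT.le) (hmono Set.self_mem_Ici hT.le hT.le) 2
  have hBsqrt : Monotone fun x => B (Real.sqrt x) := fun x y hxy =>
    hBmono _ _ (Real.sqrt_nonneg x) (Real.sqrt_le_sqrt hxy)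
  have hint : IntegrableOn (fun t => (2 * φ t * φ' t) • B (Real.sqrt (φ t ^ 2)))
      (Set.Icc 0 T) :=
    (integrableOn_Icc_deriv_smul_iff_of_deriv_nonpos (f := fun t => φ t ^ 2)
      (g := fun x => B (Real.sqrt x)) (hcφ.pow 2) hsq_deriv hsq_nonpos hT.le).2
      ((hBsqrt.monotoneOn _).integrableOn_isCompact isCompact_Icc)
  have hchange := integral_Icc_deriv_smul_of_deriv_nonpos (f := fun t => φ t ^ 2)
    (g := fun x => B (Real.sqrt x)) (hcφ.pow 2) hsq_deriv hsq_nonpos hT.le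
  have hbound := sub_le_integral_of_hasDeriv_right_of_le hT.le (hcφ'.pow 2)
    (fun t ht => ((hd2' t ht).fun_pow 2).hasDerivWithinAt) (hint.const_mul 4)
    (fun t ht => by
      have h := mul_le_mul_of_nonpos_left (hineq t ht.1) (hφ'_nonpos t ht)
      simp only [Real.sqrt_sq (hφ0 t ht.1.le), smul_eq_mul]
      norm_num
      linarith)
  rw [intervalIntegral.integral_const_mul, integral_of_le hT.le, ← integral_Icc_eq_integral_Ioc,
    hchange] at hbound
  rw [integral_of_le hle, ← integral_Icc_eq_integral_Ioc]
  simp only [Pi.pow_apply] at hbound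
  nlinarith [sq_nonneg (φ' T)]
end

section
/- Let φ : (0,∞) → (0,∞) be a continuous regularly varying function of index α > 1. Then there exists a function Φ : (0,∞) → (0,∞) which is regularly varying of index α, increasing, convex, and satisfies lim_{x→∞} Φ(x)/φ(x) = 1. -/
open Filter

/-- By Baire's theorem, if the increments `g (t + u) - g t` of a continuous function converge
for every `u`, then they are bounded uniformly for small `u ≥ 0` and large `t`. -/
lemma exists_bound_increments {g : ℝ → ℝ} (hg : Continuous g) {c : ℝ → ℝ}
    (h : ∀ u, Tendsto (fun t => g (t + u) - g t) atTop (nhds (c u))) :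
    ∃ d > 0, ∃ T C : ℝ, ∀ t ≥ T, ∀ u, 0 ≤ u → u ≤ d → |g (t + u) - g t| ≤ C := by
  let A : ℕ → Set ℝ := fun n => {u | ∀ t ≥ (n : ℝ), |g (t + u) - g t| ≤ n}
  have hclosed : ∀ n, IsClosed (A n) := by
    intro n
    have hA : A n = ⋂ t ≥ (n : ℝ), {u | |g (t + u) - g t| ≤ n} := by
      ext u
      simp [A]
    rw [hA]
    exact isClosed_iInter fun t => isClosed_iInter fun _ =>
      isClosed_le (by fun_prop) continuous_const
  have hcover : ⋃ n, A n = Set.univ := by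
    rw [Set.eq_univ_iff_forall]
    intro u
    have hev := (h u).abs.eventually (gt_mem_nhds (lt_add_one |c u|))
    obtain ⟨T, hT⟩ := eventually_atTop.1 hev
    obtain ⟨n, hn⟩ := exists_nat_ge (max T (|c u| + 1))
    refine Set.mem_iUnion.2 ⟨n, fun t ht => ?_⟩
    have h1 := hT t ((le_max_left _ _).trans (hn.trans ht))
    exact h1.le.trans ((le_max_right _ _).trans hn)
  obtain ⟨n, p, hp⟩ := nonempty_interior_of_iUnion_of_closed hclosed hcover
  obtain ⟨ε, hε, hball⟩ := Metric.isOpen_iff.1 isOpen_interior p hp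
  refine ⟨ε / 2, half_pos hε, n + p, n + n, fun t ht u hu0 hu => ?_⟩
  rw [ge_iff_le] at ht
  replace ht : (n : ℝ) ≤ t + -p := by linarith
  have hpu : p + u ∈ A n := interior_subset (hball (by
    rw [Metric.mem_ball, Real.dist_eq, add_sub_cancel_left, abs_of_nonneg hu0]
    linarith))
  have h1 := abs_le.1 (hpu _ ht)
  have h2 := abs_le.1 (interior_subset hp _ ht)
  rw [show t + -p + (p + u) = t + u by ring] at h1
  rw [show t + -p + p = t by ring] at h2
  exact abs_le.2 ⟨by linarith [h1.1, h2.2], by linarith [h1.2, h2.1]⟩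

/-- Additive form of the lower Potter bound. -/
lemma exists_linear_lower_bound_increments {g : ℝ → ℝ} (hg : Continuous g) {α β : ℝ}
    (hβ : 0 ≤ β) (hβα : β < α)
    (h : ∀ u, Tendsto (fun t => g (t + u) - g t) atTop (nhds (α * u))) :
    ∃ T C : ℝ, ∀ t ≥ T, ∀ u ≥ 0, β * u - C ≤ g (t + u) - g t := by
  obtain ⟨d, hd, T, C, hC⟩ := exists_bound_increments hg h
  obtain ⟨S, hS⟩ := eventually_atTop.1
    ((h d).eventually (lt_mem_nhds (mul_lt_mul_of_pos_right hβα hd)))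
  have hstep : ∀ n : ℕ, ∀ t ≥ S, β * (n * d) ≤ g (t + n * d) - g t := by
    intro n
    induction n with
    | zero => simp
    | succ n ih =>
      intro t ht
      have h1 := ih t ht
      have h2 := hS (t + n * d) (by have : 0 ≤ (n : ℝ) * d := by positivity
                                    linarith)
      rw [show t + n * d + d = t + ((n + 1 : ℕ) : ℝ) * d by push_cast; ring] at h2
      push_cast at h2 ⊢
      linarith
  refine ⟨max S T, C + β * d, fun t ht u hu => ?_⟩
  have hfloor := Nat.floor_le (div_nonneg hu hd.le)
  have hlt := Nat.lt_floor_add_one (u / d)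
  set n := ⌊u / d⌋₊
  rw [le_div_iff₀ hd] at hfloor
  rw [div_lt_iff₀ hd] at hlt
  have h1 := hC t ((le_max_right _ _).trans ht) (u - n * d) (by linarith) (by linarith)
  have h2 := hstep n (t + (u - n * d)) (by linarith [(le_max_left S T).trans ht])
  rw [show t + (u - n * d) + n * d = t + u by ring] at h2
  have h3 := (abs_le.1 h1).1
  have h4 : β * (u - n * d) ≤ β * d := mul_le_mul_of_nonneg_left (by linarith) hβ
  linarith

/-- The lower Potter bound for a continuous regularly varying function. -/
lemma exists_potter_bound {α β : ℝ} (hβ : 0 ≤ β) (hβα : β < α) {φ : ℝ → ℝ}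
    (hφpos : ∀ x : ℝ, 0 < x → 0 < φ x)
    (hφcont : ContinuousOn φ (Set.Ioi 0))
    (hφreg : ∀ l : ℝ, 1 ≤ l →
      Tendsto (fun x : ℝ => φ (l * x) / φ x) atTop (nhds (l ^ α))) :
    ∃ X > 0, ∃ C : ℝ, ∀ y ≥ X, ∀ x ≥ y, φ y ≤ C * (y / x) ^ β * φ x := by
  let g : ℝ → ℝ := fun t => Real.log (φ (Real.exp t))
  have hg : Continuous g := Continuous.log
    (hφcont.comp_continuous Real.continuous_exp Real.exp_pos)
    fun t => (hφpos _ (Real.exp_pos t)).ne'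
  have hnonneg : ∀ u ≥ 0, Tendsto (fun t => g (t + u) - g t) atTop (nhds (α * u)) := by
    intro u hu
    have h1 := ((hφreg (Real.exp u) (Real.one_le_exp hu)).comp Real.tendsto_exp_atTop).log
      (by positivity)
    rw [Real.log_rpow (Real.exp_pos u), Real.log_exp] at h1
    refine h1.congr fun t => ?_
    rw [Function.comp_apply, ← Real.exp_add, Real.log_div
      (hφpos _ (Real.exp_pos _)).ne' (hφpos _ (Real.exp_pos _)).ne', add_comm u t]
  have hincr : ∀ u, Tendsto (fun t => g (t + u) - g t) atTop (nhds (α * u)) := by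
    intro u
    rcases le_total 0 u with hu | hu
    · exact hnonneg u hu
    · have h1 := ((hnonneg (-u) (by linarith)).comp
        (tendsto_atTop_add_const_right atTop u tendsto_id)).neg
      rw [show -(α * -u) = α * u by ring] at h1
      refine h1.congr fun t => ?_
      simp
  obtain ⟨T, C, hC⟩ := exists_linear_lower_bound_increments hg hβ hβα hincr
  refine ⟨Real.exp T, Real.exp_pos T, Real.exp C, fun y hy x hx => ?_⟩
  have hy0 : 0 < y := (Real.exp_pos T).trans_le hy
  have hx0 : 0 < x := hy0.trans_le hx
  have h1 := hC (Real.log y) ((Real.le_log_iff_exp_le hy0).2 hy) (Real.log x - Real.log y)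
    (sub_nonneg.2 (Real.log_le_log hy0 hx))
  simp only [g, add_sub_cancel, Real.exp_log hy0, Real.exp_log hx0] at h1
  have hφx := hφpos x hx0
  have hyx : 0 < y / x := div_pos hy0 hx0
  rw [← Real.log_le_log_iff (hφpos y hy0) (by positivity),
    Real.log_mul (by positivity) hφx.ne', Real.log_mul (by positivity) (by positivity),
    Real.log_exp, Real.log_rpow hyx, Real.log_div hy0.ne' hx0.ne']
  linarith

/-- The integrand of the twofold primitive, started at `X`, of `t ↦ φ t / t ^ 2`. -/
noncomputable def primitiveKernel (φ : ℝ → ℝ) (X x : ℝ) : ℝ → ℝ :=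
  (Set.Icc X x).indicator fun t => (x - t) * (φ t / t ^ 2)

lemma integrable_primitiveKernel {φ : ℝ → ℝ} (hφcont : ContinuousOn φ (Set.Ioi 0))
    {X : ℝ} (hX : 0 < X) (x : ℝ) : MeasureTheory.Integrable (primitiveKernel φ X x) := by
  refine (MeasureTheory.integrable_indicator_iff measurableSet_Icc).2
    (ContinuousOn.integrableOn_Icc ?_)
  have hsub : Set.Icc X x ⊆ Set.Ioi 0 := fun t ht => hX.trans_le ht.1
  exact (continuousOn_const.sub continuousOn_id).mul ((hφcont.mono hsub).div
    (continuousOn_id.pow 2) fun t ht => pow_ne_zero 2 (hsub ht).ne')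

lemma primitiveKernel_eq_max_mul (φ : ℝ → ℝ) (X x t : ℝ) :
    primitiveKernel φ X x t =
      max (x - t) 0 * (Set.Ici X).indicator (fun t => φ t / t ^ 2) t := by
  by_cases hXt : X ≤ t <;> rcases le_total t x with h | h
  · simp [primitiveKernel, hXt, h]
  · rcases h.eq_or_lt with rfl | h
    · simp [primitiveKernel]
    · simp [primitiveKernel, hXt, h.not_ge, h.le]
  · simp [primitiveKernel, hXt]
  · simp [primitiveKernel, hXt]

lemma indicator_div_sq_nonneg {φ : ℝ → ℝ} (hφpos : ∀ x : ℝ, 0 < x → 0 < φ x)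
    {X : ℝ} (hX : 0 < X) (t : ℝ) :
    0 ≤ (Set.Ici X).indicator (fun t => φ t / t ^ 2) t :=
  Set.indicator_nonneg (fun t ht => by
    have := hφpos t (hX.trans_le ht)
    positivity) t

lemma integral_primitiveKernel_nonneg {φ : ℝ → ℝ} (hφpos : ∀ x : ℝ, 0 < x → 0 < φ x)
    {X : ℝ} (hX : 0 < X) (x : ℝ) : 0 ≤ ∫ t, primitiveKernel φ X x t :=
  MeasureTheory.integral_nonneg fun t => by
    rw [primitiveKernel_eq_max_mul]
    exact mul_nonneg (le_max_right _ _) (indicator_div_sq_nonneg hφpos hX t)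

lemma monotone_integral_primitiveKernel {φ : ℝ → ℝ} (hφpos : ∀ x : ℝ, 0 < x → 0 < φ x)
    (hφcont : ContinuousOn φ (Set.Ioi 0)) {X : ℝ} (hX : 0 < X) :
    Monotone fun x => ∫ t, primitiveKernel φ X x t := by
  intro x y hxy
  refine MeasureTheory.integral_mono (integrable_primitiveKernel hφcont hX x)
    (integrable_primitiveKernel hφcont hX y) fun t => ?_
  simp only [primitiveKernel_eq_max_mul]
  exact mul_le_mul_of_nonneg_right (max_le_max_right 0 (by linarith))
    (indicator_div_sq_nonneg hφpos hX t)

lemma convexOn_integral_primitiveKernel {φ : ℝ → ℝ} (hφpos : ∀ x : ℝ, 0 < x → 0 < φ x)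
    (hφcont : ContinuousOn φ (Set.Ioi 0)) {X : ℝ} (hX : 0 < X) :
    ConvexOn ℝ Set.univ fun x => ∫ t, primitiveKernel φ X x t := by
  refine ⟨convex_univ, fun x _ y _ a b ha hb hab => ?_⟩
  have hint := integrable_primitiveKernel hφcont hX
  simp only [smul_eq_mul]
  rw [← MeasureTheory.integral_const_mul, ← MeasureTheory.integral_const_mul,
    ← MeasureTheory.integral_add ((hint x).const_mul a) ((hint y).const_mul b)]
  refine MeasureTheory.integral_mono (hint _) (((hint x).const_mul a).add
    ((hint y).const_mul b)) fun t => ?_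
  simp only [primitiveKernel_eq_max_mul]
  rw [← mul_assoc, ← mul_assoc, ← add_mul]
  refine mul_le_mul_of_nonneg_right (max_le ?_ ?_) (indicator_div_sq_nonneg hφpos hX t)
  · have h1 := mul_le_mul_of_nonneg_left (le_max_left (x - t) 0) ha
    have h2 := mul_le_mul_of_nonneg_left (le_max_left (y - t) 0) hb
    have h3 : a * t + b * t = t := by rw [← add_mul, hab, one_mul]
    linarith
  · positivity

lemma integral_one_sub_mul_rpow {α : ℝ} (hα : 1 < α) :
    ∫ s in Set.Ioc (0 : ℝ) 1, (1 - s) * s ^ (α - 2) = 1 / (α * (α - 1)) := by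
  have h1 : ∀ s ∈ Set.Ioc (0 : ℝ) 1,
      (1 - s) * s ^ (α - 2) = s ^ (α - 2) - s ^ (α - 1) := by
    intro s hs
    rw [show α - 1 = (α - 2) + 1 by ring, Real.rpow_add_one hs.1.ne']
    ring
  rw [MeasureTheory.setIntegral_congr_fun measurableSet_Ioc h1,
    ← intervalIntegral.integral_of_le zero_le_one, intervalIntegral.integral_sub
      (intervalIntegral.intervalIntegrable_rpow' (by linarith))
      (intervalIntegral.intervalIntegrable_rpow' (by linarith)),
    integral_rpow (Or.inl (by linarith)), integral_rpow (Or.inl (by linarith))]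
  have h2 : α - 2 + 1 ≠ 0 := by linarith
  have h3 : α - 1 + 1 ≠ 0 := by linarith
  rw [Real.one_rpow, Real.one_rpow, Real.zero_rpow h2, Real.zero_rpow h3,
    show α - 2 + 1 = α - 1 by ring, show α - 1 + 1 = α by ring]
  have h4 : α ≠ 0 := by linarith
  have h5 : α - 1 ≠ 0 := by linarith
  field_simp
  ring

lemma mul_primitiveKernel_comp_mul (φ : ℝ → ℝ) (X : ℝ) {x : ℝ} (hx : 0 < x) (s : ℝ) :
    x * primitiveKernel φ X x (x * s) =
      (Set.Icc (X / x) 1).indicator (fun s => (1 - s) * (φ (x * s) / s ^ 2)) s := by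
  have hmem : x * s ∈ Set.Icc X x ↔ s ∈ Set.Icc (X / x) 1 := by
    rw [Set.mem_Icc, Set.mem_Icc, div_le_iff₀' hx, mul_le_iff_le_one_right hx]
  by_cases hs : s ∈ Set.Icc (X / x) 1
  · rw [primitiveKernel, Set.indicator_of_mem (hmem.2 hs), Set.indicator_of_mem hs]
    field_simp
  · rw [primitiveKernel, Set.indicator_of_notMem (mt hmem.1 hs), Set.indicator_of_notMem hs,
      mul_zero]

lemma tendsto_comp_mul_div {α : ℝ} {φ : ℝ → ℝ}
    (hφreg : ∀ l : ℝ, 1 ≤ l →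
      Tendsto (fun x : ℝ => φ (l * x) / φ x) atTop (nhds (l ^ α)))
    {s : ℝ} (hs0 : 0 < s) (hs1 : s ≤ 1) :
    Tendsto (fun x : ℝ => φ (x * s) / φ x) atTop (nhds (s ^ α)) := by
  have h1 := ((hφreg s⁻¹ ((one_le_inv₀ hs0).2 hs1)).comp
    (tendsto_id.atTop_mul_const hs0)).inv₀ (by positivity)
  rw [Real.inv_rpow hs0.le, inv_inv] at h1
  refine h1.congr fun x => ?_
  simp only [Function.comp_apply, id, inv_div]
  congr 2
  field_simp

/-- Karamata's theorem for the twofold primitive of `t ↦ φ t / t ^ 2`. -/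
lemma tendsto_integral_primitiveKernel_div {α β : ℝ} (hβ : 1 < β) (hβα : β < α) {φ : ℝ → ℝ}
    (hφpos : ∀ x : ℝ, 0 < x → 0 < φ x)
    (hφcont : ContinuousOn φ (Set.Ioi 0))
    (hφreg : ∀ l : ℝ, 1 ≤ l →
      Tendsto (fun x : ℝ => φ (l * x) / φ x) atTop (nhds (l ^ α)))
    {X C : ℝ} (hX : 0 < X) (hC : ∀ y ≥ X, ∀ x ≥ y, φ y ≤ C * (y / x) ^ β * φ x) :
    Tendsto (fun x => (∫ t, primitiveKernel φ X x t) / φ x) atTop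
      (nhds (1 / (α * (α - 1)))) := by
  rw [← integral_one_sub_mul_rpow (hβ.trans hβα),
    ← MeasureTheory.integral_indicator measurableSet_Ioc]
  have hscale : ∀ᶠ x in atTop, ∫ s, x * primitiveKernel φ X x (x * s) / φ x =
      (∫ t, primitiveKernel φ X x t) / φ x := by
    filter_upwards [eventually_gt_atTop 0] with x hx
    rw [MeasureTheory.integral_div, MeasureTheory.integral_const_mul,
      MeasureTheory.Measure.integral_comp_mul_left, smul_eq_mul, ← mul_assoc,
      abs_of_pos (inv_pos.2 hx), mul_inv_cancel₀ hx.ne', one_mul]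
  refine Tendsto.congr' hscale ?_
  refine MeasureTheory.tendsto_integral_filter_of_dominated_convergence
    ((Set.Ioc (0 : ℝ) 1).indicator fun s => C * s ^ (β - 2)) ?_ ?_ ?_ ?_
  · filter_upwards [eventually_gt_atTop 0] with x hx
    exact ((((integrable_primitiveKernel hφcont hX x).comp_mul_left' hx.ne').const_mul
      x).div_const _).aestronglyMeasurable
  · filter_upwards [eventually_gt_atTop 0] with x hx
    refine MeasureTheory.ae_of_all _ fun s => ?_
    rw [mul_primitiveKernel_comp_mul φ X hx]
    by_cases hs : s ∈ Set.Icc (X / x) 1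
    · have hs0 : 0 < s := (div_pos hX hx).trans_le hs.1
      have hφx := hφpos x hx
      have hs01 : s ∈ Set.Ioc (0 : ℝ) 1 := ⟨hs0, hs.2⟩
      have hφs := hφpos (x * s) (mul_pos hx hs0)
      have h1 := hC (x * s) ((div_le_iff₀' hx).1 hs.1) x
        (mul_le_of_le_one_right hx.le hs.2)
      rw [mul_div_cancel_left₀ s hx.ne', ← div_le_iff₀ hφx] at h1
      rw [Set.indicator_of_mem hs, Set.indicator_of_mem hs01, Real.norm_of_nonneg
        (div_nonneg (mul_nonneg (sub_nonneg.2 hs.2) (by positivity)) hφx.le),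
        Real.rpow_sub hs0, Real.rpow_two]
      calc (1 - s) * (φ (x * s) / s ^ 2) / φ x
          ≤ 1 * (φ (x * s) / s ^ 2) / φ x := by gcongr; linarith
        _ = φ (x * s) / φ x / s ^ 2 := by ring
        _ ≤ C * s ^ β / s ^ 2 := by gcongr
        _ = C * (s ^ β / s ^ 2) := by ring
    · rw [Set.indicator_of_notMem hs, zero_div, norm_zero]
      have hC0 : 0 ≤ C := by
        have h1 := hC X le_rfl X le_rfl
        have h2 := hφpos X hX
        rw [div_self hX.ne', Real.one_rpow, mul_one] at h1
        nlinarith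
      exact Set.indicator_nonneg (fun s hs => mul_nonneg hC0 (Real.rpow_nonneg hs.1.le _)) s
  · refine (MeasureTheory.integrable_indicator_iff measurableSet_Ioc).2 ?_
    exact (((intervalIntegrable_iff_integrableOn_Ioc_of_le zero_le_one).1
      (intervalIntegral.intervalIntegrable_rpow' (by linarith))).const_mul C)
  · refine MeasureTheory.ae_of_all _ fun s => ?_
    by_cases hs : s ∈ Set.Ioc (0 : ℝ) 1
    · have h1 := (tendsto_comp_mul_div hφreg hs.1 hs.2).const_mul ((1 - s) / s ^ 2)
      rw [Set.indicator_of_mem hs, Real.rpow_sub hs.1, Real.rpow_two, ← mul_div_assoc,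
        mul_div_right_comm]
      refine h1.congr' ?_
      filter_upwards [eventually_ge_atTop (X / s), eventually_gt_atTop 0] with x hx hx0
      rw [mul_primitiveKernel_comp_mul φ X hx0, Set.indicator_of_mem
        (Set.mem_Icc.2 ⟨(div_le_comm₀ hs.1 hx0).1 hx, hs.2⟩)]
      ring
    · rw [Set.indicator_of_notMem hs]
      refine tendsto_const_nhds.congr' ?_
      filter_upwards [eventually_gt_atTop 0] with x hx0
      rw [mul_primitiveKernel_comp_mul φ X hx0, Set.indicator_of_notMem, zero_div]
      exact fun h => hs ⟨(div_pos hX hx0).trans_le h.1, h.2⟩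

/-- A function satisfying a lower Potter bound with exponent `β > 1` grows superlinearly. -/
lemma tendsto_id_div_of_potter_bound {β : ℝ} (hβ : 1 < β) {φ : ℝ → ℝ}
    (hφpos : ∀ x : ℝ, 0 < x → 0 < φ x)
    {X C : ℝ} (hX : 0 < X) (hC : ∀ y ≥ X, ∀ x ≥ y, φ y ≤ C * (y / x) ^ β * φ x) :
    Tendsto (fun x => x / φ x) atTop (nhds 0) := by
  have hφX := hφpos X hX
  have hlim : Tendsto (fun x : ℝ => C * X ^ β / φ X * x ^ (-(β - 1))) atTop (nhds 0) := by
    simpa using (tendsto_rpow_neg_atTop (sub_pos.2 hβ)).const_mul (C * X ^ β / φ X)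
  refine squeeze_zero' ?_ ?_ hlim
  · filter_upwards [eventually_gt_atTop 0] with x hx
    exact div_nonneg hx.le (hφpos x hx).le
  · filter_upwards [eventually_ge_atTop X] with x hx
    have hx0 := hX.trans_le hx
    have h1 := hC X le_rfl x hx
    rw [Real.div_rpow hX.le hx0.le] at h1
    rw [div_le_iff₀ (hφpos x hx0), neg_sub, Real.rpow_sub hx0, Real.rpow_one]
    calc x = φ X * (x / φ X) := by field_simp
      _ ≤ C * (X ^ β / x ^ β) * φ x * (x / φ X) := by gcongr
      _ = C * X ^ β / φ X * (x / x ^ β) * φ x := by ring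

/-- Regular variation is invariant under asymptotic equivalence. -/
lemma tendsto_comp_mul_div_of_equivalent {l c : ℝ} (hl : 0 < l) {φ Φ : ℝ → ℝ}
    (hφpos : ∀ x : ℝ, 0 < x → 0 < φ x)
    (hφreg : Tendsto (fun x : ℝ => φ (l * x) / φ x) atTop (nhds c))
    (hequiv : Tendsto (fun x : ℝ => Φ x / φ x) atTop (nhds 1)) :
    Tendsto (fun x : ℝ => Φ (l * x) / Φ x) atTop (nhds c) := by
  have h1 := ((hequiv.comp (tendsto_id.const_mul_atTop hl)).mul hφreg).mul
    (hequiv.inv₀ one_ne_zero)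
  rw [one_mul, inv_one, mul_one] at h1
  refine h1.congr' ?_
  filter_upwards [eventually_gt_atTop 0] with x hx
  have h2 := (hφpos x hx).ne'
  have h3 := (hφpos (l * x) (mul_pos hl hx)).ne'
  simp only [Function.comp_apply, id, inv_div]
  field_simp

/-- **Proposition 2.6.** Every continuous regularly varying function `φ : (0,∞) → (0,∞)`
of index `α > 1` is asymptotically equivalent to a function `Φ : (0,∞) → (0,∞)` which is
regularly varying of index `α`, increasing and convex. -/
theorem regularly_varying_convex_equivalent
    (α : ℝ) (hα : 1 < α)
    (φ : ℝ → ℝ)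
    (hφpos : ∀ x : ℝ, 0 < x → 0 < φ x)
    (hφcont : ContinuousOn φ (Set.Ioi 0))
    (hφreg : ∀ l : ℝ, 1 ≤ l →
      Tendsto (fun x : ℝ => φ (l * x) / φ x) atTop (nhds (l ^ α))) :
    ∃ Φ : ℝ → ℝ,
      (∀ x : ℝ, 0 < x → 0 < Φ x) ∧
      (∀ l : ℝ, 1 ≤ l →
        Tendsto (fun x : ℝ => Φ (l * x) / Φ x) atTop (nhds (l ^ α))) ∧
      StrictMonoOn Φ (Set.Ioi 0) ∧
      ConvexOn ℝ (Set.Ioi 0) Φ ∧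
      Tendsto (fun x : ℝ => Φ x / φ x) atTop (nhds 1) := by
  obtain ⟨β, hβ, hβα⟩ := exists_between hα
  obtain ⟨X, hX, C, hC⟩ :=
    exists_potter_bound (zero_le_one.trans hβ.le) hβα hφpos hφcont hφreg
  have hc : 0 < α * (α - 1) := mul_pos (by linarith) (by linarith)
  let Φ : ℝ → ℝ := fun x => x + α * (α - 1) * ∫ t, primitiveKernel φ X x t
  have hequiv : Tendsto (fun x : ℝ => Φ x / φ x) atTop (nhds 1) := by
    have h1 := (tendsto_id_div_of_potter_bound hβ hφpos hX hC).add
      ((tendsto_integral_primitiveKernel_div hβ hβα hφpos hφcont hφreg hX hC).const_mul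
        (α * (α - 1)))
    rw [mul_one_div_cancel hc.ne', zero_add] at h1
    refine h1.congr fun x => ?_
    simp only [Φ]
    ring
  refine ⟨Φ, fun x hx => ?_, fun l hl => ?_, fun x _ y _ hxy => ?_, ?_, hequiv⟩
  · exact add_pos_of_pos_of_nonneg hx
      (mul_nonneg hc.le (integral_primitiveKernel_nonneg hφpos hX x))
  · exact tendsto_comp_mul_div_of_equivalent (by linarith) hφpos (hφreg l hl) hequiv
  · exact add_lt_add_of_lt_of_le hxy (mul_le_mul_of_nonneg_left
      (monotone_integral_primitiveKernel hφpos hφcont hX hxy.le) hc.le)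
  · exact (convexOn_id (convex_Ioi 0)).add (((convexOn_integral_primitiveKernel hφpos hφcont
      hX).smul hc.le).subset (Set.subset_univ _) (convex_Ioi 0))
end
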